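/- Let K be a compact convex subset of the Euclidean plane with nonempty interior, and let L = {x : ⟪x, n⟫ = c} be a line passing through an interior point of K. Then L intersects the topological boundary (frontier) of K in exactly two points. -/

import Mathlib

open scoped RealInnerProductSpace

open Set Filter Topology

/-- An open ray issuing from an interior point of a compact convex set meets the frontier of
that set at exactly one parameter. -/
theorem Convex.exists_forall_add_smul_mem_frontier_iff {E : Type*} [NormedAddCommGroup E]
    [NormedSpace ℝ E] {K : Set E} (hK : Convex ℝ K) (hKc : IsCompact K) {x : E}
    (hx : x ∈ interior K) {v : E} (hv : v ≠ 0) :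
    ∃ t : ℝ, 0 < t ∧ ∀ s : ℝ, 0 < s → (x + s • v ∈ frontier K ↔ s = t) := by
  have hemb : IsClosedEmbedding fun s : ℝ => x + s • v :=
    (Homeomorph.addLeft x).isClosedEmbedding.comp (isClosedEmbedding_smul_left hv)
  have hT : IsCompact (Ici 0 ∩ (fun s : ℝ => x + s • v) ⁻¹' K) :=
    (hemb.isCompact_preimage hKc).inter_left isClosed_Ici
  obtain ⟨t, ⟨ht0, htK⟩, hmax⟩ :=
    hT.exists_isGreatest ⟨0, self_mem_Ici, by simpa using interior_subset hx⟩
  have hnot : x + t • v ∉ interior K := fun h => by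
    have hnhds : ∀ᶠ s in 𝓝 t, x + s • v ∈ interior K :=
      hemb.continuous.continuousAt.eventually (isOpen_interior.mem_nhds h)
    obtain ⟨s, hs, hts⟩ :=
      ((hnhds.filter_mono nhdsWithin_le_nhds).and (self_mem_nhdsWithin (s := Ioi t))).exists
    exact hts.not_ge (hmax ⟨mem_Ici.2 ((mem_Ici.1 ht0).trans hts.le), interior_subset (s := K) hs⟩)
  have htpos : 0 < t := lt_of_le_of_ne ht0 fun h => hnot (by simpa [← h] using hx)
  have hlt : ∀ r s : ℝ, 0 < r → r < s → x + s • v ∈ closure K → x + r • v ∈ interior K := by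
    intro r s hr hrs hs
    have hs0 : 0 < s := hr.trans hrs
    refine hK.openSegment_interior_closure_subset_interior hx hs ?_
    rw [openSegment_eq_image']
    refine ⟨r / s, ⟨by positivity, (div_lt_one hs0).2 hrs⟩, ?_⟩
    simp [smul_smul, div_mul_cancel₀ _ hs0.ne']
  refine ⟨t, htpos, fun s hs => ⟨fun hsf => ?_, ?_⟩⟩
  · rcases lt_trichotomy s t with h | h | h
    · exact absurd (hlt s t hs h (subset_closure htK)) hsf.2
    · exact h
    · exact absurd (hlt t s htpos h hsf.1) hnot
  · rintro rfl
    exact ⟨subset_closure htK, hnot⟩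

/-- A line through an interior point of a compact convex set meets the frontier of that set in
exactly two points. -/
theorem Convex.exists_range_add_smul_inter_frontier_eq_pair {E : Type*} [NormedAddCommGroup E]
    [NormedSpace ℝ E] {K : Set E} (hK : Convex ℝ K) (hKc : IsCompact K) {x : E}
    (hx : x ∈ interior K) {v : E} (hv : v ≠ 0) :
    ∃ a b : E, a ≠ b ∧ range (fun s : ℝ => x + s • v) ∩ frontier K = {a, b} := by
  obtain ⟨t, ht, hft⟩ := hK.exists_forall_add_smul_mem_frontier_iff hKc hx hv
  obtain ⟨u, hu, hfu⟩ := hK.exists_forall_add_smul_mem_frontier_iff hKc hx (neg_ne_zero.2 hv)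
  refine ⟨x + t • v, x + u • -v, fun h => ?_, ?_⟩
  · rw [smul_neg, ← neg_smul] at h
    have := smul_left_injective ℝ hv (add_left_cancel h)
    linarith
  · ext y
    constructor
    · rintro ⟨⟨s, rfl⟩, hs⟩
      rcases lt_trichotomy s 0 with h | rfl | h
      · right
        have hsu := (hfu (-s) (neg_pos.2 h)).1 (by simpa using hs)
        simp [← hsu]
      · exact absurd hx (by simpa using hs.2)
      · left
        simp [(hft s h).1 hs]
    · rintro (rfl | rfl)
      · exact ⟨⟨t, rfl⟩, (hft t ht).2 rfl⟩
      · exact ⟨⟨-u, by simp⟩, (hfu u hu).2 rfl⟩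

/-- A line in the Euclidean plane given by a normal vector, in parametric form. -/
theorem EuclideanSpace.setOf_inner_eq_inner_eq_range {n : EuclideanSpace ℝ (Fin 2)} (hn : n ≠ 0)
    (x : EuclideanSpace ℝ (Fin 2)) :
    {y | ⟪y, n⟫ = ⟪x, n⟫} = range fun s : ℝ => x + s • !₂[-n 1, n 0] := by
  have hpos : n 0 ^ 2 + n 1 ^ 2 ≠ 0 := fun h => hn <| by
    obtain ⟨h0, h1⟩ := mul_self_add_mul_self_eq_zero.1 (by simpa only [sq] using h)
    ext i
    fin_cases i <;> simpa
  ext y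
  simp only [mem_ofPred_eq, mem_range, PiLp.inner_apply, Fin.sum_univ_two, RCLike.inner_apply,
    conj_trivial]
  constructor
  · intro h
    refine ⟨((y 1 - x 1) * n 0 - (y 0 - x 0) * n 1) / (n 0 ^ 2 + n 1 ^ 2), ?_⟩
    ext i
    fin_cases i
    · simp only [Fin.zero_eta, PiLp.add_apply, PiLp.smul_apply, smul_eq_mul, Matrix.cons_val_zero]
      field_simp
      linear_combination (-n 0) * h
    · simp only [Fin.mk_one, PiLp.add_apply, PiLp.smul_apply, smul_eq_mul, Matrix.cons_val_one,
        Matrix.cons_val_fin_one]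
      field_simp
      linear_combination (-n 1) * h
  · rintro ⟨s, rfl⟩
    simp
    ring

/-- A line `{x | ⟪x, n⟫ = c}` passing through an interior point of a compact convex set `K`
in the Euclidean plane with nonempty interior meets the topological boundary of `K` in
exactly two points. -/
theorem line_through_interior_meets_frontier_in_two_points
    (K : Set (EuclideanSpace ℝ (Fin 2))) (hKc : IsCompact K) (hK : Convex ℝ K)
    (hint : (interior K).Nonempty)
    (n : EuclideanSpace ℝ (Fin 2)) (hn : n ≠ 0) (c : ℝ)
    (hthrough : ∃ x ∈ interior K, ⟪x, n⟫ = c) :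
    ∃ a b : EuclideanSpace ℝ (Fin 2), a ≠ b ∧
      {x | ⟪x, n⟫ = c} ∩ frontier K = {a, b} := by
  obtain ⟨x, hx, rfl⟩ := hthrough
  have hv : !₂[-n 1, n 0] ≠ 0 := fun h => hn <| by
    have h0 := congrArg (fun w : EuclideanSpace ℝ (Fin 2) => w 0) h
    have h1 := congrArg (fun w : EuclideanSpace ℝ (Fin 2) => w 1) h
    ext i
    fin_cases i
    · simpa using h1
    · simpa using h0
  rw [EuclideanSpace.setOf_inner_eq_inner_eq_range hn x]
  exact hK.exists_range_add_smul_inter_frontier_eq_pair hKc hx hv
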